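/- arXiv:1101.0172 — 2 statements merged into one kernel-verified Lean document; each statement's English description precedes it below -/
import Mathlib

section
/- Suppose w ∈ PB∩C²(ℝᵈ) and a positive function κ: ℝᵈ → (0,∞) satisfy min( −sup_{β∈B}{L^βw + f(·,β)}, w − Mw ) ≥ κ in S and min( w − g, w − Mw ) ≥ κ in ℝᵈ∖S. If v is a viscosity supersolution of the elliptic QVI, then for every m ∈ ℕ, m ≥ 1, the function v_m := (1 − 1/m)v + (1/m)w is a viscosity supersolution of the perturbed QVI min( −sup_{β∈B}{L^βu + f^β}, u − Mu ) − κ/m = 0 in S, min( u − g, u − Mu ) − κ/m = 0 in ℝᵈ∖S; that is, the supersolution inequalities hold with right-hand side κ(x₀)/m in place of 0. -/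
open Filter Topology Metric Set MeasureTheory Matrix
open scoped RealInnerProductSpace ENNReal

noncomputable section

abbrev Euc (n : ℕ) : Type := EuclideanSpace ℝ (Fin n)

/-- Upper semicontinuous envelope `u*`. -/
noncomputable def uscEnv {d : ℕ} (u : Euc d → ℝ) (x : Euc d) : ℝ := Filter.limsup u (𝓝 x)

/-- Lower semicontinuous envelope `u_*`. -/
noncomputable def lscEnv {d : ℕ} (u : Euc d → ℝ) (x : Euc d) : ℝ := Filter.liminf u (𝓝 x)

/-- Membership in the space `PB` of measurable, polynomially bounded functions of order `b`. -/
def PB {d : ℕ} (b : ℝ) (u : Euc d → ℝ) : Prop :=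
  Measurable u ∧ ∃ C : ℝ, ∀ y : Euc d, |u y| ≤ C * (1 + ‖y‖ ^ b)

/-- Membership in `PB_p`: members of `PB` whose growth is at most of order `p`. -/
def PBp {d : ℕ} (b p : ℝ) (u : Euc d → ℝ) : Prop :=
  PB b u ∧ ∃ C : ℝ, ∀ y : Euc d, |u y| ≤ C * (1 + ‖y‖ ^ p)

/-- The Hessian matrix `D²φ(x)` of a function `φ : ℝᵈ → ℝ`. -/
noncomputable def hess {d : ℕ} (φ : Euc d → ℝ) (x : Euc d) : Matrix (Fin d) (Fin d) ℝ :=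
  Matrix.of fun i j =>
    iteratedFDeriv ℝ 2 φ x ![EuclideanSpace.single i (1:ℝ), EuclideanSpace.single j (1:ℝ)]

/-- The intervention operator `M u (x) = sup { u(Γ(x,ζ)) + K(x,ζ) : ζ ∈ Z(x) }`. -/
noncomputable def Mop {d : ℕ} (Γ : Euc d → Euc d → Euc d) (K : Euc d → Euc d → ℝ)
    (Z : Euc d → Set (Euc d)) (u : Euc d → ℝ) (x : Euc d) : ℝ :=
  sSup ((fun ζ => u (Γ x ζ) + K x ζ) '' Z x)

/-- The elliptic integro-differential operator
`L^β φ(x) = (1/2)tr(σσᵀ D²φ) + ⟨μ,∇φ⟩ − cφ + ∫ [φ(x+ℓ) − φ(x) − ⟨∇φ(x),ℓ⟩ 1_{|z|<1}] dν`. -/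
noncomputable def Lop {d dm k : ℕ} {B : Type*}
    (σ : Euc d → B → Matrix (Fin d) (Fin dm) ℝ) (μ : Euc d → B → Euc d)
    (c : Euc d → ℝ) (ν : Measure (Euc k)) (ℓ : Euc d → B → Euc k → Euc d)
    (β : B) (φ : Euc d → ℝ) (x : Euc d) : ℝ :=
  (1/2) * Matrix.trace (σ x β * (σ x β)ᵀ * hess φ x)
    + ⟪μ x β, gradient φ x⟫ - c x * φ x
    + ∫ z, (φ (x + ℓ x β z) - φ x
        - (if ‖z‖ < 1 then ⟪gradient φ x, ℓ x β z⟫ else 0)) ∂ν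

/-- Viscosity subsolution (Definition 1) of the elliptic QVI, with right-hand side `rhs`
(the plain QVI corresponds to `rhs = 0`). -/
def IsSubsol {d dm k : ℕ} {B : Type*} (S : Set (Euc d))
    (σ : Euc d → B → Matrix (Fin d) (Fin dm) ℝ) (μ : Euc d → B → Euc d)
    (f : Euc d → B → ℝ) (c : Euc d → ℝ) (g : Euc d → ℝ) (ν : Measure (Euc k))
    (ℓ : Euc d → B → Euc k → Euc d) (Γ : Euc d → Euc d → Euc d) (K : Euc d → Euc d → ℝ)
    (Z : Euc d → Set (Euc d)) (b : ℝ) (rhs : Euc d → ℝ) (u : Euc d → ℝ) : Prop :=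
  PB b u ∧ ∀ (x0 : Euc d) (φ : Euc d → ℝ), PB b φ → ContDiff ℝ 2 φ →
    uscEnv u x0 = φ x0 → (∀ x, uscEnv u x - φ x ≤ uscEnv u x0 - φ x0) →
    (x0 ∈ S →
      min (-(⨆ β : B, (Lop σ μ c ν ℓ β φ x0 + f x0 β)))
        (uscEnv u x0 - Mop Γ K Z (uscEnv u) x0) ≤ rhs x0) ∧
    (x0 ∉ S →
      min (uscEnv u x0 - g x0) (uscEnv u x0 - Mop Γ K Z (uscEnv u) x0) ≤ rhs x0)

/-- Viscosity supersolution (Definition 1) of the elliptic QVI, with right-hand side `rhs`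
(the plain QVI corresponds to `rhs = 0`). -/
def IsSupersol {d dm k : ℕ} {B : Type*} (S : Set (Euc d))
    (σ : Euc d → B → Matrix (Fin d) (Fin dm) ℝ) (μ : Euc d → B → Euc d)
    (f : Euc d → B → ℝ) (c : Euc d → ℝ) (g : Euc d → ℝ) (ν : Measure (Euc k))
    (ℓ : Euc d → B → Euc k → Euc d) (Γ : Euc d → Euc d → Euc d) (K : Euc d → Euc d → ℝ)
    (Z : Euc d → Set (Euc d)) (b : ℝ) (rhs : Euc d → ℝ) (u : Euc d → ℝ) : Prop :=
  PB b u ∧ ∀ (x0 : Euc d) (φ : Euc d → ℝ), PB b φ → ContDiff ℝ 2 φ →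
    lscEnv u x0 = φ x0 → (∀ x, lscEnv u x0 - φ x0 ≤ lscEnv u x - φ x) →
    (x0 ∈ S →
      rhs x0 ≤ min (-(⨆ β : B, (Lop σ μ c ν ℓ β φ x0 + f x0 β)))
        (lscEnv u x0 - Mop Γ K Z (lscEnv u) x0)) ∧
    (x0 ∉ S →
      rhs x0 ≤ min (lscEnv u x0 - g x0) (lscEnv u x0 - Mop Γ K Z (lscEnv u) x0))

lemma PB.exists_bound_of_norm_le {d : ℕ} {b : ℝ} (hb : 0 ≤ b) {u : Euc d → ℝ} (hu : PB b u) :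
    ∃ C : ℝ, 0 ≤ C ∧ ∀ r : ℝ, ∀ y : Euc d, ‖y‖ ≤ r → |u y| ≤ C * (1 + r ^ b) := by
  obtain ⟨-, C, hC⟩ := hu
  have hC0 : 0 ≤ C := by
    have h0 := (abs_nonneg _).trans (hC 0)
    have h1 : (0:ℝ) < 1 + ‖(0 : Euc d)‖ ^ b := by positivity
    exact nonneg_of_mul_nonneg_left h0 h1
  refine ⟨C, hC0, fun r y hy => (hC y).trans ?_⟩
  gcongr

lemma PB.eventually_abs_le {d : ℕ} {b : ℝ} (hb : 0 ≤ b) {u : Euc d → ℝ} (hu : PB b u) (r : ℝ) :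
    ∃ R : ℝ, ∀ x : Euc d, ‖x‖ ≤ r → ∀ᶠ y in 𝓝 x, |u y| ≤ R := by
  obtain ⟨C, -, hC⟩ := hu.exists_bound_of_norm_le hb
  refine ⟨C * (1 + (r + 1) ^ b), fun x hx => ?_⟩
  filter_upwards [Metric.ball_mem_nhds x one_pos] with y hy
  refine hC _ _ ?_
  have h1 : ‖y - x‖ < 1 := by simpa [dist_eq_norm] using hy
  have h2 : ‖y‖ ≤ ‖y - x‖ + ‖x‖ := by simpa using norm_add_le (y - x) x
  linarith

lemma PB.linearCombination {d : ℕ} {b : ℝ} {u w : Euc d → ℝ} (hu : PB b u) (hw : PB b w)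
    (θ s : ℝ) : PB b (fun x => θ * u x + s * w x) := by
  obtain ⟨hum, C, hC⟩ := hu
  obtain ⟨hwm, D, hD⟩ := hw
  refine ⟨(hum.const_mul θ).add (hwm.const_mul s), |θ| * C + |s| * D, fun y => ?_⟩
  calc |θ * u y + s * w y| ≤ |θ * u y| + |s * w y| := abs_add_le _ _
    _ = |θ| * |u y| + |s| * |w y| := by rw [abs_mul, abs_mul]
    _ ≤ |θ| * (C * (1 + ‖y‖ ^ b)) + |s| * (D * (1 + ‖y‖ ^ b)) := by
      gcongr
      · exact hC y
      · exact hD y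
    _ = _ := by ring

section Bounded

variable {d : ℕ} {u : Euc d → ℝ} {x : Euc d} {R : ℝ}

lemma isBoundedUnder_ge_of_abs_le (h : ∀ᶠ y in 𝓝 x, |u y| ≤ R) :
    IsBoundedUnder (· ≥ ·) (𝓝 x) u :=
  ⟨-R, by rw [eventually_map]; filter_upwards [h] with y hy using (abs_le.1 hy).1⟩

lemma isBoundedUnder_le_of_abs_le (h : ∀ᶠ y in 𝓝 x, |u y| ≤ R) :
    IsBoundedUnder (· ≤ ·) (𝓝 x) u :=
  ⟨R, by rw [eventually_map]; filter_upwards [h] with y hy using (abs_le.1 hy).2⟩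

lemma lscEnv_le_of_abs_le (h : ∀ᶠ y in 𝓝 x, |u y| ≤ R) : lscEnv u x ≤ R :=
  (liminf_le_limsup (isBoundedUnder_le_of_abs_le h) (isBoundedUnder_ge_of_abs_le h)).trans
    (limsup_le_of_le (isBoundedUnder_ge_of_abs_le h).isCoboundedUnder_le
      (h.mono fun _ hy => (abs_le.1 hy).2))

lemma lscEnv_linearCombination {w : Euc d → ℝ} {θ s : ℝ} (hθ : 0 ≤ θ)
    (h : ∀ᶠ y in 𝓝 x, |u y| ≤ R) (hw : ContinuousAt w x) :
    lscEnv (fun y => θ * u y + s * w y) x = θ * lscEnv u x + s * w x := by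
  have hmul : lscEnv (fun y => θ * u y) x = θ * lscEnv u x :=
    (Monotone.map_liminf_of_continuousAt (f := fun t : ℝ => θ * t)
      (fun a b hab => mul_le_mul_of_nonneg_left hab hθ) u (by fun_prop)
      (isBoundedUnder_le_of_abs_le h).isCoboundedUnder_ge (isBoundedUnder_ge_of_abs_le h)).symm
  have hw' : Tendsto (fun y => s * w y) (𝓝 x) (𝓝 (s * w x)) := hw.const_mul s
  have hθu : ∀ᶠ y in 𝓝 x, |θ * u y| ≤ θ * R := by
    filter_upwards [h] with y hy
    rw [abs_mul, abs_of_nonneg hθ]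
    gcongr
  have h1 := isBoundedUnder_ge_of_abs_le hθu
  have h2 := isBoundedUnder_le_of_abs_le hθu
  rw [← hmul]
  apply le_antisymm
  · have := liminf_add_le hw'.isBoundedUnder_ge hw'.isBoundedUnder_le h1 h2.isCoboundedUnder_ge
    rw [hw'.limsup_eq] at this
    rw [add_comm, lscEnv, lscEnv]
    refine le_trans (le_of_eq ?_) this
    congr 1
    ext y
    simp [add_comm]
  · have := le_liminf_add h1 h2 hw'.isBoundedUnder_ge hw'.isCoboundedUnder_ge
    rw [hw'.liminf_eq] at this
    exact this

end Bounded

lemma Mop_linearCombination_le {d : ℕ} {Γ : Euc d → Euc d → Euc d} {K : Euc d → Euc d → ℝ}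
    {Z : Euc d → Set (Euc d)} {u w : Euc d → ℝ} {x : Euc d} {θ s : ℝ} (hθ : 0 ≤ θ) (hs : 0 ≤ s)
    (hθs : θ + s = 1) (hZ : (Z x).Nonempty)
    (hu : BddAbove ((fun ζ => u (Γ x ζ) + K x ζ) '' Z x))
    (hw : BddAbove ((fun ζ => w (Γ x ζ) + K x ζ) '' Z x)) :
    Mop Γ K Z (fun y => θ * u y + s * w y) x ≤ θ * Mop Γ K Z u x + s * Mop Γ K Z w x := by
  refine csSup_le (hZ.image _) ?_
  rintro _ ⟨ζ, hζ, rfl⟩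
  have h1 : u (Γ x ζ) + K x ζ ≤ Mop Γ K Z u x := le_csSup hu ⟨ζ, hζ, rfl⟩
  have h2 : w (Γ x ζ) + K x ζ ≤ Mop Γ K Z w x := le_csSup hw ⟨ζ, hζ, rfl⟩
  calc θ * u (Γ x ζ) + s * w (Γ x ζ) + K x ζ
      = θ * (u (Γ x ζ) + K x ζ) + s * (w (Γ x ζ) + K x ζ) := by
        linear_combination (- K x ζ) * hθs
    _ ≤ _ := by gcongr

lemma bddAbove_intervention {d : ℕ} {Γ : Euc d → Euc d → Euc d} {K : Euc d → Euc d → ℝ}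
    (hΓ : Continuous fun q : Euc d × Euc d => Γ q.1 q.2)
    (hK : Continuous fun q : Euc d × Euc d => K q.1 q.2)
    {s : Set (Euc d)} (hs : IsCompact s) {u : Euc d → ℝ}
    (hu : ∀ r : ℝ, ∃ R : ℝ, ∀ y : Euc d, ‖y‖ ≤ r → u y ≤ R) (x : Euc d) :
    BddAbove ((fun ζ => u (Γ x ζ) + K x ζ) '' s) := by
  obtain ⟨r, hr⟩ := hs.exists_bound_of_continuousOn
    (hΓ.comp (Continuous.prodMk_right x)).continuousOn
  obtain ⟨D, hD⟩ := hs.exists_bound_of_continuousOn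
    (hK.comp (Continuous.prodMk_right x)).continuousOn
  obtain ⟨R, hR⟩ := hu r
  refine ⟨R + D, ?_⟩
  rintro _ ⟨ζ, hζ, rfl⟩
  exact add_le_add (hR _ (hr ζ hζ)) ((le_abs_self _).trans (hD ζ hζ))

/-- First-order Taylor remainder bound, uniform on bounded increments. -/
lemma exists_taylor_remainder_bound {E : Type*} [NormedAddCommGroup E] [NormedSpace ℝ E]
    [ProperSpace E] {φ : E → ℝ} (hφ : ContDiff ℝ 2 φ) (x : E) (r : ℝ) :
    ∃ A : ℝ, 0 ≤ A ∧ ∀ h : E, ‖h‖ ≤ r → |φ (x + h) - φ x - fderiv ℝ φ x h| ≤ A * ‖h‖ ^ 2 := by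
  have hφ' : ContDiff ℝ 1 (fderiv ℝ φ) := hφ.fderiv_right (by norm_num)
  obtain ⟨A, hA⟩ := (isCompact_closedBall x r).exists_bound_of_continuousOn
    (hφ'.continuous_fderiv one_ne_zero).continuousOn
  refine ⟨max A 0, le_max_right _ _, fun h hh => ?_⟩
  have hsub : closedBall x ‖h‖ ⊆ closedBall x r := closedBall_subset_closedBall hh
  have hx : x ∈ closedBall x ‖h‖ := mem_closedBall_self (norm_nonneg h)
  have hxh : x + h ∈ closedBall x ‖h‖ := by simp
  have hlip : ∀ y ∈ closedBall x ‖h‖, ‖fderiv ℝ φ y - fderiv ℝ φ x‖ ≤ max A 0 * ‖h‖ := by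
    intro y hy
    refine ((convex_closedBall x ‖h‖).norm_image_sub_le_of_norm_fderiv_le (𝕜 := ℝ)
      (fun z _ => (hφ'.differentiable one_ne_zero) z)
      (fun z hz => (hA z (hsub hz)).trans (le_max_left A 0)) hx hy).trans ?_
    have : ‖y - x‖ ≤ ‖h‖ := by simpa [dist_eq_norm] using hy
    gcongr
  have := (convex_closedBall x ‖h‖).norm_image_sub_le_of_norm_hasFDerivWithin_le' (𝕜 := ℝ)
    (fun z _ => ((hφ.differentiable two_ne_zero) z).hasFDerivAt.hasFDerivWithinAt) hlip hx hxh
  rw [add_sub_cancel_left, Real.norm_eq_abs] at this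
  linarith

lemma IsLocalMin.fderiv_fderiv_self_nonneg {E : Type*} [NormedAddCommGroup E] [NormedSpace ℝ E]
    {φ : E → ℝ} (hφ : ContDiff ℝ 2 φ) {x : E} (hx : IsLocalMin φ x) (h : E) :
    0 ≤ fderiv ℝ (fderiv ℝ φ) x h h := by
  have hline : ∀ t : ℝ, HasDerivAt (fun t : ℝ => x + t • h) h t := fun t => by
    simpa using ((hasDerivAt_id t).smul_const h).const_add x
  have hd1 : deriv (fun t : ℝ => φ (x + t • h)) = fun t => fderiv ℝ φ (x + t • h) h := by
    ext t
    exact ((hφ.differentiable two_ne_zero _).hasFDerivAt.comp_hasDerivAt t (hline t)).deriv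
  have hφ' : Differentiable ℝ (fderiv ℝ φ) :=
    (hφ.fderiv_right (m := 1) (by norm_num)).differentiable one_ne_zero
  have hd2 : deriv (deriv (fun t : ℝ => φ (x + t • h))) 0 = fderiv ℝ (fderiv ℝ φ) x h h := by
    rw [hd1]
    have hx0 : HasFDerivAt (fderiv ℝ φ) (fderiv ℝ (fderiv ℝ φ) x) (x + (0:ℝ) • h) := by
      simpa using (hφ' x).hasFDerivAt
    have hd : HasDerivAt (fun t : ℝ => fderiv ℝ φ (x + t • h)) (fderiv ℝ (fderiv ℝ φ) x h) 0 :=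
      hx0.comp_hasDerivAt (0:ℝ) (hline 0)
    have := hd.clm_apply (hasDerivAt_const (0:ℝ) h)
    rw [map_zero, add_zero] at this
    exact this.deriv
  have hcont : Continuous fun t : ℝ => x + t • h := by fun_prop
  have htend : Tendsto (fun t : ℝ => x + t • h) (𝓝 0) (𝓝 x) := by
    simpa using hcont.tendsto 0
  have hmin : IsLocalMin (fun t : ℝ => φ (x + t • h)) 0 := by
    simpa [IsLocalMin, IsMinFilter] using htend.eventually hx
  by_contra! hneg
  rw [← hd2] at hneg
  have hmax := isLocalMax_of_deriv_deriv_neg hneg hmin.deriv_eq_zero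
    (hφ.continuous.comp hcont).continuousAt
  have hconst : (fun t : ℝ => φ (x + t • h)) =ᶠ[𝓝 0] fun _ => φ (x + (0:ℝ) • h) := by
    filter_upwards [hmin, hmax] with t h1 h2 using le_antisymm h2 h1
  rw [hconst.deriv.deriv_eq] at hneg
  simp at hneg

section Hessian

variable {d : ℕ} {φ ψ : Euc d → ℝ} {x : Euc d}

lemma hess_apply (φ : Euc d → ℝ) (x : Euc d) (i j : Fin d) :
    hess φ x i j = fderiv ℝ (fderiv ℝ φ) x (EuclideanSpace.single i 1)
      (EuclideanSpace.single j 1) := by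
  simp [hess, iteratedFDeriv_two_apply]

lemma fderiv_linearCombination (hφ : ContDiff ℝ 2 φ) (hψ : ContDiff ℝ 2 ψ) (θ s : ℝ) :
    fderiv ℝ (fun y => θ * φ y + s * ψ y) = fun y => θ • fderiv ℝ φ y + s • fderiv ℝ ψ y := by
  ext1 y
  exact (((hφ.differentiable two_ne_zero y).hasFDerivAt.const_mul θ).add
    ((hψ.differentiable two_ne_zero y).hasFDerivAt.const_mul s)).fderiv

lemma hess_linearCombination (hφ : ContDiff ℝ 2 φ) (hψ : ContDiff ℝ 2 ψ) (θ s : ℝ) :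
    hess (fun y => θ * φ y + s * ψ y) x = θ • hess φ x + s • hess ψ x := by
  have hφ' := (hφ.fderiv_right (m := 1) (by norm_num)).differentiable one_ne_zero x
  have hψ' := (hψ.fderiv_right (m := 1) (by norm_num)).differentiable one_ne_zero x
  have := ((hφ'.hasFDerivAt.const_smul θ).add (hψ'.hasFDerivAt.const_smul s)).fderiv
  ext i j
  rw [hess_apply, fderiv_linearCombination hφ hψ]
  simp only [Matrix.add_apply, Matrix.smul_apply, hess_apply]
  erw [this]
  simp

lemma gradient_linearCombination (hφ : ContDiff ℝ 2 φ) (hψ : ContDiff ℝ 2 ψ) (θ s : ℝ) :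
    gradient (fun y => θ * φ y + s * ψ y) x = θ • gradient φ x + s • gradient ψ x := by
  simp [gradient, fderiv_linearCombination hφ hψ]

lemma trace_mul_hess_nonneg {dm : ℕ} (hφ : ContDiff ℝ 2 φ) (hx : IsLocalMin φ x)
    (A : Matrix (Fin d) (Fin dm) ℝ) : 0 ≤ Matrix.trace (A * Aᵀ * hess φ x) := by
  have : Matrix.trace (A * Aᵀ * hess φ x) = ∑ j, fderiv ℝ (fderiv ℝ φ) x
      (∑ i, A i j • EuclideanSpace.single i 1) (∑ i, A i j • EuclideanSpace.single i 1) := by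
    rw [Matrix.mul_assoc, Matrix.trace_mul_comm]
    simp only [Matrix.trace, Matrix.diag_apply, Matrix.mul_apply, Matrix.transpose_apply,
      hess_apply, map_sum, map_smul, _root_.sum_apply, _root_.smul_apply,
      smul_eq_mul, Finset.sum_mul, Finset.mul_sum]
    refine Finset.sum_congr rfl fun j _ => Finset.sum_congr rfl fun i _ =>
      Finset.sum_congr rfl fun i' _ => by ring
  rw [this]
  exact Finset.sum_nonneg fun j _ => hx.fderiv_fderiv_self_nonneg hφ _

end Hessian

/-- The integrand of the nonlocal part of `Lop`, for the jump map `h`. -/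
def jumpIncr {d k : ℕ} (φ : Euc d → ℝ) (x : Euc d) (h : Euc k → Euc d) (z : Euc k) : ℝ :=
  φ (x + h z) - φ x - (if ‖z‖ < 1 then ⟪gradient φ x, h z⟫ else 0)

/-- The weight dominating `jumpIncr`. -/
def jumpWeight {k : ℕ} (p q : ℝ) (z : Euc k) : ℝ := if ‖z‖ < 1 then ‖z‖ ^ q else ‖z‖ ^ p

/-- The growth condition on a jump map. -/
def JumpGrowth {d k : ℕ} (a q C : ℝ) (h : Euc k → Euc d) : Prop :=
  ∀ z : Euc k, (1 ≤ ‖z‖ → ‖h z‖ ≤ C * (1 + ‖z‖ ^ a)) ∧ (‖z‖ < 1 → ‖h z‖ ≤ C * ‖z‖ ^ (q / 2))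

section Jump

variable {d k : ℕ} {φ ψ : Euc d → ℝ} {x : Euc d} {h : Euc k → Euc d}

lemma integrable_jumpWeight {ν : Measure (Euc k)} {p q : ℝ}
    (hp : (∫⁻ z in {z : Euc k | 1 ≤ ‖z‖}, ENNReal.ofReal (‖z‖ ^ p) ∂ν) ≠ ⊤)
    (hq : (∫⁻ z in {z : Euc k | ‖z‖ < 1}, ENNReal.ofReal (‖z‖ ^ q) ∂ν) ≠ ⊤) :
    Integrable (jumpWeight p q) ν := by
  have hint : ∀ (t : Set (Euc k)) (r : ℝ),
      (∫⁻ z in t, ENNReal.ofReal (‖z‖ ^ r) ∂ν) ≠ ⊤ → IntegrableOn (fun z => ‖z‖ ^ r) t ν := by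
    intro t r ht
    refine (lintegral_ofReal_ne_top_iff_integrable
      (measurable_norm.pow_const r).aestronglyMeasurable ?_).1 ht
    exact Eventually.of_forall fun z => by positivity
  have hs : MeasurableSet {z : Euc k | ‖z‖ < 1} := measurableSet_lt measurable_norm measurable_const
  have hc : {z : Euc k | ‖z‖ < 1}ᶜ = {z : Euc k | 1 ≤ ‖z‖} := by ext; simp
  have hpw : jumpWeight p q
      = {z : Euc k | ‖z‖ < 1}.piecewise (fun z => ‖z‖ ^ q) fun z => ‖z‖ ^ p := by
    ext z
    simp [jumpWeight, Set.piecewise]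
  rw [hpw]
  exact Integrable.piecewise hs (hint _ _ hq) (hc ▸ hint _ _ hp)

lemma exists_abs_jumpIncr_le {a b p q C : ℝ} (ha : 0 ≤ a) (hb : 0 ≤ b) (hab : a * b ≤ p)
    (hp : 0 ≤ p) (hq : 0 ≤ q)
    (hφ : PB b φ) (hφ2 : ContDiff ℝ 2 φ) (x : Euc d) :
    ∃ A : ℝ, ∀ h : Euc k → Euc d, JumpGrowth a q C h →
      ∀ z, |jumpIncr φ x h z| ≤ A * jumpWeight p q z := by
  obtain ⟨D, hD0, hD⟩ := hφ.exists_bound_of_norm_le hb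
  obtain ⟨T, hT0, hT⟩ := exists_taylor_remainder_bound hφ2 x (max C 0)
  set C' := max C 0
  have hC' : 0 ≤ C' := le_max_right _ _
  have hCC : C ≤ C' := le_max_left _ _
  refine ⟨max (T * C' ^ 2) (D * (1 + (‖x‖ + 2 * C') ^ b) + |φ x|), fun h hh z => ?_⟩
  by_cases hz : ‖z‖ < 1
  · have h1 : ‖h z‖ ≤ C' * ‖z‖ ^ (q / 2) := ((hh z).2 hz).trans (by gcongr)
    have h2 : ‖z‖ ^ (q / 2) ≤ 1 := Real.rpow_le_one (norm_nonneg _) hz.le (by positivity)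
    have h3 := hT (h z) (h1.trans (mul_le_of_le_one_right hC' h2))
    simp only [jumpIncr, jumpWeight, hz, if_true, inner_gradient_left]
    have h4 : (‖z‖ ^ (q / 2)) ^ 2 = ‖z‖ ^ q := by
      rw [← Real.rpow_natCast, ← Real.rpow_mul (norm_nonneg _)]
      norm_num
    calc _ ≤ T * ‖h z‖ ^ 2 := h3
      _ ≤ T * (C' * ‖z‖ ^ (q / 2)) ^ 2 := by gcongr
      _ = T * C' ^ 2 * ‖z‖ ^ q := by rw [mul_pow, h4]; ring
      _ ≤ _ := by gcongr; exact le_max_left _ _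
  · have hz1 : 1 ≤ ‖z‖ := not_lt.1 hz
    have ha1 : 1 ≤ ‖z‖ ^ a := Real.one_le_rpow hz1 ha
    have hp1 : 1 ≤ ‖z‖ ^ p := Real.one_le_rpow hz1 hp
    have h1 : ‖h z‖ ≤ C' * (1 + ‖z‖ ^ a) := ((hh z).1 hz1).trans (by gcongr)
    have h2 : ‖x + h z‖ ≤ (‖x‖ + 2 * C') * ‖z‖ ^ a := by
      have := norm_add_le x (h z)
      nlinarith [norm_nonneg x]
    have h3 : ((‖x‖ + 2 * C') * ‖z‖ ^ a) ^ b ≤ (‖x‖ + 2 * C') ^ b * ‖z‖ ^ p := by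
      rw [Real.mul_rpow (by positivity) (by positivity), ← Real.rpow_mul (norm_nonneg _)]
      gcongr
    simp only [jumpIncr, jumpWeight, hz, if_false, sub_zero]
    calc |φ (x + h z) - φ x| ≤ |φ (x + h z)| + |φ x| := abs_sub _ _
      _ ≤ D * (‖z‖ ^ p + (‖x‖ + 2 * C') ^ b * ‖z‖ ^ p) + |φ x| * ‖z‖ ^ p := by
        refine add_le_add ((hD _ _ h2).trans ?_) (le_mul_of_one_le_right (abs_nonneg _) hp1)
        gcongr
      _ = (D * (1 + (‖x‖ + 2 * C') ^ b) + |φ x|) * ‖z‖ ^ p := by ring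
      _ ≤ _ := by gcongr; exact le_max_right _ _

lemma measurable_jumpIncr (hφ : Measurable φ) (hh : Measurable h) :
    Measurable (jumpIncr φ x h) := by
  unfold jumpIncr
  refine ((hφ.comp (hh.const_add x)).sub_const _).sub (Measurable.ite ?_ ?_ measurable_const)
  · exact measurableSet_lt measurable_norm measurable_const
  · exact hh.const_inner

lemma jumpIncr_linearCombination (hφ : ContDiff ℝ 2 φ) (hψ : ContDiff ℝ 2 ψ) (θ s : ℝ)
    (z : Euc k) : jumpIncr (fun y => θ * φ y + s * ψ y) x h z
      = θ * jumpIncr φ x h z + s * jumpIncr ψ x h z := by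
  simp only [jumpIncr, gradient_linearCombination hφ hψ, inner_add_left, real_inner_smul_left]
  split_ifs <;> ring

end Jump

section Generator

variable {d dm k : ℕ} {B : Type*} {σ : Euc d → B → Matrix (Fin d) (Fin dm) ℝ}
  {μ : Euc d → B → Euc d} {c : Euc d → ℝ} {ν : Measure (Euc k)} {ℓ : Euc d → B → Euc k → Euc d}
  {φ ψ : Euc d → ℝ} {x : Euc d} {β : B}

lemma Lop_linearCombination (hφ : ContDiff ℝ 2 φ) (hψ : ContDiff ℝ 2 ψ)
    (hφi : Integrable (jumpIncr φ x (ℓ x β)) ν) (hψi : Integrable (jumpIncr ψ x (ℓ x β)) ν)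
    (θ s : ℝ) : Lop σ μ c ν ℓ β (fun y => θ * φ y + s * ψ y) x
      = θ * Lop σ μ c ν ℓ β φ x + s * Lop σ μ c ν ℓ β ψ x := by
  have hint : ∫ z, jumpIncr (fun y => θ * φ y + s * ψ y) x (ℓ x β) z ∂ν
      = θ * ∫ z, jumpIncr φ x (ℓ x β) z ∂ν + s * ∫ z, jumpIncr ψ x (ℓ x β) z ∂ν := by
    simp only [jumpIncr_linearCombination hφ hψ]
    rw [integral_add (hφi.const_mul θ) (hψi.const_mul s), integral_const_mul, integral_const_mul]
  unfold jumpIncr at hint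
  unfold Lop
  rw [hint, hess_linearCombination hφ hψ, gradient_linearCombination hφ hψ]
  simp only [Matrix.mul_add, Matrix.mul_smul, Matrix.trace_add, Matrix.trace_smul, inner_add_right,
    real_inner_smul_right, smul_eq_mul]
  ring

/-- Positive maximum principle. -/
lemma Lop_nonneg_of_isMin (hφ : ContDiff ℝ 2 φ) (hx : φ x = 0) (hmin : ∀ y, 0 ≤ φ y) :
    0 ≤ Lop σ μ c ν ℓ β φ x := by
  have hloc : IsLocalMin φ x := Eventually.of_forall fun y => by rw [hx]; exact hmin y
  have hgrad : gradient φ x = 0 := by simp [gradient, hloc.fderiv_eq_zero]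
  have htr := trace_mul_hess_nonneg hφ hloc (σ x β)
  have hint : 0 ≤ ∫ z, φ (x + ℓ x β z) ∂ν := integral_nonneg fun z => hmin _
  simp only [Lop, hgrad, hx, inner_zero_left, inner_zero_right, ite_self, sub_zero, mul_zero,
    add_zero]
  positivity

lemma bddAbove_range_Lop [TopologicalSpace B] [CompactSpace B] {f : Euc d → B → ℝ}
    (hσ : Continuous (σ x)) (hμ : Continuous (μ x)) (hf : Continuous (f x))
    {G : Euc k → ℝ} (hG : Integrable G ν) (hφ : ∀ β z, |jumpIncr φ x (ℓ x β) z| ≤ G z) :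
    BddAbove (range fun β => Lop σ μ c ν ℓ β φ x + f x β) := by
  have hcont : Continuous fun β => (1/2) * Matrix.trace (σ x β * (σ x β)ᵀ * hess φ x)
      + ⟪μ x β, gradient φ x⟫ - c x * φ x + f x β := by fun_prop
  obtain ⟨R, hR⟩ := (isCompact_range hcont).bddAbove
  refine ⟨R + ∫ z, G z ∂ν, ?_⟩
  rintro _ ⟨β, rfl⟩
  have h1 := hR ⟨β, rfl⟩
  have h2 : ∫ z, jumpIncr φ x (ℓ x β) z ∂ν ≤ ∫ z, G z ∂ν :=
    (Real.le_norm_self _).trans (norm_integral_le_of_norm_le hG (Eventually.of_forall (hφ β)))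
  unfold jumpIncr at h2
  simp only [Lop]
  linarith

end Generator

/-- if `w ∈ PB ∩ C²(ℝᵈ)` and a positive function `κ` satisfy
`min(−sup_β{L^β w + f^β}, w − Mw) ≥ κ` in `S` and `min(w − g, w − Mw) ≥ κ` in `ℝᵈ∖S`,
and `v` is a viscosity supersolution of the elliptic QVI, then for every `m ≥ 1`
the function `v_m := (1 − 1/m)v + (1/m)w` is a viscosity supersolution of the perturbed
QVI with right-hand side `κ/m`. -/
theorem stmt14 {d dm k : ℕ} (hd : 1 ≤ d) (hk : 1 ≤ k)
    {B : Type*} [MetricSpace B] [CompactSpace B] [Nonempty B]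
    (S : Set (Euc d)) (hS : IsOpen S)
    (σ : Euc d → B → Matrix (Fin d) (Fin dm) ℝ)
    (hσ : Continuous (fun q : Euc d × B => σ q.1 q.2))
    (μ : Euc d → B → Euc d) (hμ : Continuous (fun q : Euc d × B => μ q.1 q.2))
    (f : Euc d → B → ℝ) (hf : Continuous (fun q : Euc d × B => f q.1 q.2))
    (c : Euc d → ℝ) (hc : Continuous c) (hc0 : ∀ x, 0 ≤ c x)
    (g : Euc d → ℝ) (hg : Continuous g)
    (ν : Measure (Euc k))
    (hν : (∫⁻ z, ENNReal.ofReal (min (‖z‖ ^ 2) 1) ∂ν) ≠ ⊤)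
    (ℓ : Euc d → B → Euc k → Euc d)
    (hℓ : Continuous (fun q : Euc d × B × Euc k => ℓ q.1 q.2.1 q.2.2))
    (a b pstar qstar : ℝ) (ha : 0 ≤ a) (hb : 0 ≤ b) (hpstar : 0 < pstar)
    (hab : a * b ≤ pstar) (hqstar : 0 ≤ qstar)
    (hνp : (∫⁻ z in {z : Euc k | 1 ≤ ‖z‖}, ENNReal.ofReal (‖z‖ ^ pstar) ∂ν) ≠ ⊤)
    (hνq : (∫⁻ z in {z : Euc k | ‖z‖ < 1}, ENNReal.ofReal (‖z‖ ^ qstar) ∂ν) ≠ ⊤)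
    (hgrowth : ∀ x : Euc d, ∃ U ∈ 𝓝 x, ∃ C : ℝ, ∀ x' ∈ U, ∀ (β : B) (z : Euc k),
      (1 ≤ ‖z‖ → ‖ℓ x' β z‖ ≤ C * (1 + ‖z‖ ^ a)) ∧
      (‖z‖ < 1 → ‖ℓ x' β z‖ ≤ C * ‖z‖ ^ (qstar / 2)))
    (Γ : Euc d → Euc d → Euc d) (hΓ : Continuous (fun q : Euc d × Euc d => Γ q.1 q.2))
    (K : Euc d → Euc d → ℝ) (hK : Continuous (fun q : Euc d × Euc d => K q.1 q.2))
    (Z : Euc d → Set (Euc d))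
    (hZne : ∀ x : Euc d, (Z x).Nonempty) (hZcp : ∀ x : Euc d, IsCompact (Z x))
    (hZH : ∀ (xs : ℕ → Euc d) (x : Euc d), Filter.Tendsto xs Filter.atTop (𝓝 x) →
      Filter.Tendsto (fun n => Metric.hausdorffDist (Z (xs n)) (Z x)) Filter.atTop (𝓝 (0:ℝ)))
    (w : Euc d → ℝ) (hwPB : PB b w) (hwC2 : ContDiff ℝ 2 w)
    (κ : Euc d → ℝ) (hκ : ∀ x, 0 < κ x)
    (hwS : ∀ x ∈ S,
      κ x ≤ min (-(⨆ β : B, (Lop σ μ c ν ℓ β w x + f x β))) (w x - Mop Γ K Z w x))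
    (hwSc : ∀ x ∉ S, κ x ≤ min (w x - g x) (w x - Mop Γ K Z w x))
    (v : Euc d → ℝ)
    (hv : IsSupersol S σ μ f c g ν ℓ Γ K Z b (fun _ => 0) v)
    (m : ℕ) (hm : 1 ≤ m) :
    IsSupersol S σ μ f c g ν ℓ Γ K Z b (fun x => κ x / m)
      (fun x => (1 - 1/(m:ℝ)) * v x + (1/(m:ℝ)) * w x) := by
  obtain ⟨hvPB, hvsup⟩ := hv
  have hm0 : (1:ℝ) ≤ m := by exact_mod_cast hm
  set s : ℝ := 1 / (m:ℝ) with hs_def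
  set θ : ℝ := 1 - s with hθ_def
  have hs0 : 0 < s := by positivity
  have hθ0 : 0 ≤ θ := sub_nonneg.2 ((div_le_one (by linarith)).2 hm0)
  have hθs : θ + s = 1 := by simp [hθ_def]
  have hκm : ∀ x, κ x / m = s * κ x := fun x => by rw [hs_def]; ring
  have hlsc : lscEnv (fun x => θ * v x + s * w x) = fun x => θ * lscEnv v x + s * w x := by
    ext x
    obtain ⟨R, hR⟩ := hvPB.eventually_abs_le hb ‖x‖
    exact lscEnv_linearCombination hθ0 (hR x le_rfl) hwC2.continuous.continuousAt
  refine ⟨hvPB.linearCombination hwPB θ s, fun x φ hφPB hφ2 hφx hmin => ?_⟩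
  simp only [hlsc, hκm] at hφx hmin ⊢
  have hbddv := bddAbove_intervention hΓ hK (hZcp x) (u := lscEnv v) (fun r => by
    obtain ⟨R, hR⟩ := hvPB.eventually_abs_le hb r
    exact ⟨R, fun y hy => lscEnv_le_of_abs_le (hR y hy)⟩) x
  have hbddw := bddAbove_intervention hΓ hK (hZcp x) (u := w) (fun r => by
    obtain ⟨C, -, hC⟩ := hwPB.exists_bound_of_norm_le hb
    exact ⟨_, fun y hy => (le_abs_self _).trans (hC r y hy)⟩) x
  have hM := Mop_linearCombination_le hθ0 hs0.le hθs (hZne x) hbddv hbddw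
  have htest : 0 < θ → ∃ ψ : Euc d → ℝ, PB b ψ ∧ ContDiff ℝ 2 ψ ∧ lscEnv v x = ψ x ∧
      (∀ y, lscEnv v x - ψ x ≤ lscEnv v y - ψ y) ∧ φ = fun y => θ * ψ y + s * w y := by
    intro hθ
    refine ⟨fun y => θ⁻¹ * φ y + (-(θ⁻¹ * s)) * w y, hφPB.linearCombination hwPB _ _,
      (contDiff_const.mul hφ2).add (contDiff_const.mul hwC2), ?_, fun y => ?_, ?_⟩
    · beta_reduce
      rw [← hφx]
      field_simp
      ring
    · have h1 := mul_le_mul_of_nonneg_left (hmin y) (inv_pos.2 hθ).le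
      have h2 : ∀ p q r : ℝ, θ⁻¹ * (θ * p + s * q - r) = p - (θ⁻¹ * r + -(θ⁻¹ * s) * q) := by
        intro p q r
        field_simp
        ring
      rwa [h2, h2] at h1
    · ext y
      field_simp
      ring
  have hMsuper : (0 < θ → 0 ≤ lscEnv v x - Mop Γ K Z (lscEnv v) x) →
      κ x ≤ w x - Mop Γ K Z w x →
      s * κ x ≤ θ * lscEnv v x + s * w x
        - Mop Γ K Z (fun y => θ * lscEnv v y + s * w y) x := by
    intro hv' hw'
    have h1 : 0 ≤ θ * (lscEnv v x - Mop Γ K Z (lscEnv v) x) := by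
      rcases hθ0.eq_or_lt with h | h
      · simp [← h]
      · exact mul_nonneg h.le (hv' h)
    nlinarith [mul_le_mul_of_nonneg_left hw' hs0.le]
  refine ⟨fun hxS => ?_, fun hxS => ?_⟩
  · obtain ⟨hwL, hwM⟩ := le_min_iff.1 (hwS x hxS)
    obtain ⟨U, hU, C, hC⟩ := hgrowth x
    have hgr : ∀ β, JumpGrowth a qstar C (ℓ x β) := fun β z => hC x (mem_of_mem_nhds hU) β z
    have hW := integrable_jumpWeight hνp hνq
    have hjump : ∀ ψ : Euc d → ℝ, PB b ψ → ContDiff ℝ 2 ψ →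
        (∀ β, Integrable (jumpIncr ψ x (ℓ x β)) ν) ∧
          BddAbove (range fun β => Lop σ μ c ν ℓ β ψ x + f x β) := by
      intro ψ hψPB hψ2
      obtain ⟨A, hA⟩ := exists_abs_jumpIncr_le (k := k) (C := C) ha hb hab hpstar.le hqstar
        hψPB hψ2 x
      refine ⟨fun β => (hW.const_mul A).mono' (measurable_jumpIncr hψPB.1
        (hℓ.comp (by fun_prop : Continuous fun z => (x, β, z))).measurable).aestronglyMeasurable
        (Eventually.of_forall (hA _ (hgr β))), ?_⟩
      exact bddAbove_range_Lop (hσ.comp (Continuous.prodMk_right x))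
        (hμ.comp (Continuous.prodMk_right x)) (hf.comp (Continuous.prodMk_right x))
        (hW.const_mul A) fun β => hA _ (hgr β)
    obtain ⟨hwi, hwb⟩ := hjump w hwPB hwC2
    refine le_min ?_ (hMsuper (fun hθ => ?_) hwM)
    · rw [le_neg]
      refine ciSup_le fun β => ?_
      have h1 : Lop σ μ c ν ℓ β w x + f x β ≤ -κ x := (le_ciSup hwb β).trans (le_neg.1 hwL)
      rcases hθ0.eq_or_lt with hθ | hθ
      · have hs1 : s = 1 := by linarith
        simp only [← hθ, hs1, zero_mul, one_mul, zero_add] at hφx hmin ⊢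
        have h2 := Lop_linearCombination (σ := σ) (μ := μ) (c := c) hwC2 hφ2 (hwi β)
          ((hjump φ hφPB hφ2).1 β) 1 (-1)
        have h3 : 0 ≤ Lop σ μ c ν ℓ β (fun y => 1 * w y + (-1) * φ y) x :=
          Lop_nonneg_of_isMin ((contDiff_const.mul hwC2).add (contDiff_const.mul hφ2))
            (by linarith) fun y => by linarith [hmin y]
        linarith
      · obtain ⟨ψ, hψPB, hψ2, hψx, hψmin, hφψ⟩ := htest hθ
        obtain ⟨hψi, hψb⟩ := hjump ψ hψPB hψ2
        have h2 := (le_min_iff.1 ((hvsup x ψ hψPB hψ2 hψx hψmin).1 hxS)).1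
        have h3 : Lop σ μ c ν ℓ β ψ x + f x β ≤ 0 := by
          linarith [le_ciSup hψb β]
        rw [hφψ, Lop_linearCombination hψ2 hwC2 (hψi β) (hwi β)]
        nlinarith [mul_le_mul_of_nonneg_left h3 hθ.le, mul_le_mul_of_nonneg_left h1 hs0.le]
    · obtain ⟨ψ, hψPB, hψ2, hψx, hψmin, -⟩ := htest hθ
      exact (le_min_iff.1 ((hvsup x ψ hψPB hψ2 hψx hψmin).1 hxS)).2
  · obtain ⟨hwg, hwM⟩ := le_min_iff.1 (hwSc x hxS)
    have hsup : 0 < θ → 0 ≤ lscEnv v x - g x ∧ 0 ≤ lscEnv v x - Mop Γ K Z (lscEnv v) x := by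
      intro hθ
      obtain ⟨ψ, hψPB, hψ2, hψx, hψmin, -⟩ := htest hθ
      exact le_min_iff.1 ((hvsup x ψ hψPB hψ2 hψx hψmin).2 hxS)
    refine le_min ?_ (hMsuper (fun hθ => (hsup hθ).2) hwM)
    have h1 : 0 ≤ θ * (lscEnv v x - g x) := by
      rcases hθ0.eq_or_lt with h | h
      · simp [← h]
      · exact mul_nonneg h.le (hsup h).1
    nlinarith [mul_le_mul_of_nonneg_left hwg hs0.le]
end
end

section
/- Suppose w ∈ PB∩C²(ℝᵈ) and a positive function κ: ℝᵈ → (0,∞) satisfy min( −sup_{β∈B}{L^βw + f(·,β)}, w − Mw ) ≥ κ in S and min( w − g, w − Mw ) ≥ κ in ℝᵈ∖S. If u is a viscosity subsolution of the elliptic QVI, then for every m ∈ ℕ, m ≥ 1, the function u_m := (1 + 1/m)u − (1/m)w is a viscosity subsolution of the elliptic QVI, and moreover a viscosity subsolution of the QVI with right-hand side −κ/m, i.e. the subsolution inequalities hold in the form min(·,·) ≤ −κ(x₀)/m. -/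
open Filter Topology Metric Set MeasureTheory Matrix
open scoped RealInnerProductSpace ENNReal

noncomputable section

theorem PB.nonneg_bound {d : ℕ} {b : ℝ} {u : Euc d → ℝ} (hu : PB b u) :
    ∃ C : ℝ, 0 ≤ C ∧ ∀ y : Euc d, |u y| ≤ C * (1 + ‖y‖ ^ b) := by
  obtain ⟨C, hC⟩ := hu.2
  refine ⟨|C|, abs_nonneg C, fun y => (hC y).trans ?_⟩
  have : 0 ≤ 1 + ‖y‖ ^ b := by positivity
  gcongr
  exact le_abs_self C

theorem PB.bounded_on_ball {d : ℕ} {b : ℝ} (hb : 0 ≤ b) {u : Euc d → ℝ} (hu : PB b u) (R : ℝ) :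
    ∃ A : ℝ, ∀ y : Euc d, ‖y‖ ≤ R → |u y| ≤ A := by
  obtain ⟨C, hC0, hC⟩ := hu.nonneg_bound
  refine ⟨C * (1 + R ^ b), fun y hy => (hC y).trans ?_⟩
  gcongr

theorem PB.linear_comb {d : ℕ} {b : ℝ} {u v : Euc d → ℝ} (hu : PB b u) (hv : PB b v) (p q : ℝ) :
    PB b (fun x => p * u x + q * v x) := by
  obtain ⟨C, hC⟩ := hu.2
  obtain ⟨D, hD⟩ := hv.2
  refine ⟨(hu.1.const_mul p).add (hv.1.const_mul q), |p| * C + |q| * D, fun y => ?_⟩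
  calc |p * u y + q * v y| ≤ |p| * |u y| + |q| * |v y| := by
        simpa only [abs_mul] using abs_add_le (p * u y) (q * v y)
    _ ≤ |p| * (C * (1 + ‖y‖ ^ b)) + |q| * (D * (1 + ‖y‖ ^ b)) := by
        gcongr
        · exact hC y
        · exact hD y
    _ = (|p| * C + |q| * D) * (1 + ‖y‖ ^ b) := by ring

theorem PB.eventually_bounded {d : ℕ} {b : ℝ} (hb : 0 ≤ b) {u : Euc d → ℝ} (hu : PB b u)
    (R : ℝ) : ∃ A : ℝ, ∀ x : Euc d, ‖x‖ ≤ R → ∀ᶠ y in 𝓝 x, |u y| ≤ A := by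
  obtain ⟨A, hA⟩ := hu.bounded_on_ball hb (R + 1)
  refine ⟨A, fun x hx => ?_⟩
  filter_upwards [Metric.ball_mem_nhds x one_pos] with y hy
  refine hA y ?_
  have h₁ : ‖y - x‖ < 1 := by simpa [dist_eq_norm] using hy
  have h₂ : ‖y‖ ≤ ‖y - x‖ + ‖x‖ := by simpa using norm_add_le (y - x) x
  linarith

theorem isBoundedUnder_of_eventually_abs_le {α : Type*} {l : Filter α} {u : α → ℝ} {A : ℝ}
    (h : ∀ᶠ y in l, |u y| ≤ A) :
    l.IsBoundedUnder (· ≤ ·) u ∧ l.IsBoundedUnder (· ≥ ·) u :=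
  ⟨⟨A, h.mono fun _ hy => (abs_le.1 hy).2⟩, ⟨-A, h.mono fun _ hy => (abs_le.1 hy).1⟩⟩

theorem PB.uscEnv_bounded_on_ball {d : ℕ} {b : ℝ} (hb : 0 ≤ b) {u : Euc d → ℝ} (hu : PB b u)
    (R : ℝ) : ∃ A : ℝ, ∀ x : Euc d, ‖x‖ ≤ R → uscEnv u x ≤ A := by
  obtain ⟨A, hA⟩ := hu.eventually_bounded hb R
  refine ⟨A, fun x hx => ?_⟩
  refine Filter.limsup_le_of_le
    (isBoundedUnder_of_eventually_abs_le (hA x hx)).2.isCoboundedUnder_le ?_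
  exact (hA x hx).mono fun y hy => (abs_le.1 hy).2

theorem uscEnv_mul_sub {d : ℕ} {b : ℝ} (hb : 0 ≤ b) {u w : Euc d → ℝ} (hu : PB b u)
    (hw : Continuous w) {p : ℝ} (hp : 0 ≤ p) (q : ℝ) (x : Euc d) :
    uscEnv (fun y => p * u y - q * w y) x = p * uscEnv u x - q * w x := by
  obtain ⟨A, hA⟩ := hu.eventually_bounded hb ‖x‖
  obtain ⟨h₁, h₂⟩ := isBoundedUnder_of_eventually_abs_le (hA x le_rfl)
  have hmul : Filter.limsup (fun y => p * u y) (𝓝 x) = p * Filter.limsup u (𝓝 x) := by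
    have hmono : Monotone (fun t : ℝ => p * t) := fun s t hst => by dsimp only; gcongr
    exact (hmono.map_limsup_of_continuousAt (F := 𝓝 x) u (by fun_prop) h₁
      h₂.isCoboundedUnder_le).symm
  have hpA : ∀ᶠ y in 𝓝 x, |p * u y| ≤ p * A := (hA x le_rfl).mono fun y hy => by
    rw [abs_mul, abs_of_nonneg hp]; gcongr
  obtain ⟨h₃, h₄⟩ := isBoundedUnder_of_eventually_abs_le hpA
  have hw' : Tendsto (fun y => -(q * w y)) (𝓝 x) (𝓝 (-(q * w x))) :=
    ((hw.const_mul q).neg).tendsto x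
  have hlim := hw'.limsup_eq
  have hle : Filter.limsup ((fun y => p * u y) + fun y => -(q * w y)) (𝓝 x)
      ≤ Filter.limsup (fun y => p * u y) (𝓝 x) + Filter.limsup (fun y => -(q * w y)) (𝓝 x) :=
    limsup_add_le h₄ h₃ hw'.isBoundedUnder_ge.isCoboundedUnder_le hw'.isBoundedUnder_le
  have hge : Filter.limsup (fun y => p * u y) (𝓝 x) + Filter.liminf (fun y => -(q * w y)) (𝓝 x)
      ≤ Filter.limsup ((fun y => p * u y) + fun y => -(q * w y)) (𝓝 x) :=
    le_limsup_add h₃ h₄.isCoboundedUnder_le hw'.isBoundedUnder_le hw'.isBoundedUnder_ge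
  rw [hw'.liminf_eq] at hge
  rw [hlim] at hle
  have := le_antisymm hle hge
  rw [hmul] at this
  simp only [uscEnv, sub_eq_add_neg]
  exact this

theorem bddAbove_image_Mop {d : ℕ} {Γ : Euc d → Euc d → Euc d} {K : Euc d → Euc d → ℝ}
    {Z : Euc d → Set (Euc d)} {x : Euc d} (hΓ : Continuous (Γ x)) (hK : Continuous (K x))
    (hZ : IsCompact (Z x)) {v : Euc d → ℝ} (hv : ∀ R : ℝ, ∃ A : ℝ, ∀ y, ‖y‖ ≤ R → v y ≤ A) :
    BddAbove ((fun ζ => v (Γ x ζ) + K x ζ) '' Z x) := by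
  obtain ⟨R, hR⟩ := hZ.bddAbove_image hΓ.norm.continuousOn
  obtain ⟨D, hD⟩ := hZ.bddAbove_image hK.continuousOn
  obtain ⟨A, hA⟩ := hv R
  refine ⟨A + D, ?_⟩
  rintro _ ⟨ζ, hζ, rfl⟩
  exact add_le_add (hA _ (hR ⟨ζ, hζ, rfl⟩)) (hD ⟨ζ, hζ, rfl⟩)

theorem exists_taylor_bound {E : Type*} [NormedAddCommGroup E] [NormedSpace ℝ E]
    [FiniteDimensional ℝ E] {φ : E → ℝ} (hφ : ContDiff ℝ 2 φ) (x : E) (R : ℝ) :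
    ∃ C : ℝ, 0 ≤ C ∧ ∀ h : E, ‖h‖ ≤ R → |φ (x + h) - φ x - fderiv ℝ φ x h| ≤ C * ‖h‖ ^ 2 := by
  have hd : ContDiff ℝ 1 (fderiv ℝ φ) := hφ.fderiv_right (by norm_num)
  have hφd : Differentiable ℝ φ := hφ.differentiable (by norm_num)
  obtain ⟨C, hC⟩ := (isCompact_closedBall x R).exists_bound_of_continuousOn
    (hd.continuous_fderiv one_ne_zero).continuousOn
  refine ⟨|C|, abs_nonneg C, fun h hh => ?_⟩
  have hlip : ∀ y ∈ closedBall x ‖h‖, ‖fderiv ℝ φ y - fderiv ℝ φ x‖ ≤ |C| * ‖h‖ := by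
    intro y hy
    refine ((convex_closedBall x ‖h‖).norm_image_sub_le_of_norm_fderiv_le
      (fun z _ => (hd.differentiable one_ne_zero) z)
      (fun z hz => (hC z (closedBall_subset_closedBall hh hz)).trans (le_abs_self C))
      (mem_closedBall_self (norm_nonneg h)) hy).trans ?_
    gcongr
    simpa [dist_eq_norm] using hy
  have := (convex_closedBall x ‖h‖).norm_image_sub_le_of_norm_fderiv_le'
    (fun z _ => hφd z) hlip (mem_closedBall_self (norm_nonneg h))
    (show x + h ∈ closedBall x ‖h‖ by simp [dist_eq_norm])
  simpa [pow_two, mul_assoc] using this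

/-- The integrand of the nonlocal term of `Lop`. -/
def levyIntegrand {d k : ℕ} (j : Euc k → Euc d) (φ : Euc d → ℝ) (x : Euc d) (z : Euc k) : ℝ :=
  φ (x + j z) - φ x - (if ‖z‖ < 1 then ⟪gradient φ x, j z⟫ else 0)

theorem measurable_levyIntegrand {d k : ℕ} {j : Euc k → Euc d} (hj : Continuous j)
    {φ : Euc d → ℝ} (hφ : Continuous φ) (x : Euc d) : Measurable (levyIntegrand j φ x) := by
  refine Measurable.sub (Continuous.measurable (by fun_prop)) (Measurable.ite ?_ ?_ measurable_const)
  · exact measurableSet_lt measurable_norm measurable_const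
  · exact Continuous.measurable (by fun_prop)

theorem integrableOn_norm_rpow {k : ℕ} {ν : Measure (Euc k)} {s : Set (Euc k)} {p : ℝ}
    (h : (∫⁻ z in s, ENNReal.ofReal (‖z‖ ^ p) ∂ν) ≠ ⊤) :
    IntegrableOn (fun z : Euc k => ‖z‖ ^ p) s ν := by
  refine (lintegral_ofReal_ne_top_iff_integrable ?_ ?_).1 h
  · exact (measurable_norm.pow_const p).aestronglyMeasurable
  · exact Filter.Eventually.of_forall fun z => by positivity

theorem exists_integrable_bound_levyIntegrand {d k : ℕ} {ν : Measure (Euc k)}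
    {a b p q : ℝ} (ha : 0 ≤ a) (hb : 0 ≤ b) (hab : a * b ≤ p) (hq : 0 ≤ q)
    (hνp : (∫⁻ z in {z : Euc k | 1 ≤ ‖z‖}, ENNReal.ofReal (‖z‖ ^ p) ∂ν) ≠ ⊤)
    (hνq : (∫⁻ z in {z : Euc k | ‖z‖ < 1}, ENNReal.ofReal (‖z‖ ^ q) ∂ν) ≠ ⊤)
    {φ : Euc d → ℝ} (hφPB : PB b φ) (hφ : ContDiff ℝ 2 φ) (x : Euc d) (C : ℝ) :
    ∃ G : Euc k → ℝ, Integrable G ν ∧ ∀ j : Euc k → Euc d,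
      (∀ z, (1 ≤ ‖z‖ → ‖j z‖ ≤ C * (1 + ‖z‖ ^ a)) ∧
        (‖z‖ < 1 → ‖j z‖ ≤ C * ‖z‖ ^ (q / 2))) →
      ∀ z, ‖levyIntegrand j φ x z‖ ≤ G z := by
  obtain ⟨A, hA0, hA⟩ := hφPB.nonneg_bound
  obtain ⟨T, hT0, hT⟩ := exists_taylor_bound hφ x |C|
  set D := ‖x‖ + |C| * 2
  have hms : MeasurableSet {z : Euc k | ‖z‖ < 1} :=
    measurableSet_lt measurable_norm measurable_const
  have hml : MeasurableSet {z : Euc k | 1 ≤ ‖z‖} :=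
    measurableSet_le measurable_const measurable_norm
  refine ⟨{z : Euc k | ‖z‖ < 1}.indicator (fun z => T * C ^ 2 * ‖z‖ ^ q) +
    {z : Euc k | 1 ≤ ‖z‖}.indicator (fun z => (A * (1 + D ^ b) + |φ x|) * ‖z‖ ^ p),
    ((integrable_indicator_iff hms).2 ((integrableOn_norm_rpow hνq).const_mul _)).add
      ((integrable_indicator_iff hml).2 ((integrableOn_norm_rpow hνp).const_mul _)), ?_⟩
  intro j hj z
  rcases lt_or_ge ‖z‖ 1 with hz | hz
  · have hjz : ‖j z‖ ≤ |C| * ‖z‖ ^ (q / 2) := ((hj z).2 hz).trans (by gcongr; exact le_abs_self C)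
    have hle : ‖z‖ ^ (q / 2) ≤ 1 := Real.rpow_le_one (norm_nonneg z) hz.le (by positivity)
    have hjR : ‖j z‖ ≤ |C| := hjz.trans (mul_le_of_le_one_right (abs_nonneg C) hle)
    have hsq : (‖z‖ ^ (q / 2)) ^ 2 = ‖z‖ ^ q := by
      rw [← Real.rpow_natCast, ← Real.rpow_mul (norm_nonneg z)]; norm_num
    have hgrad : ⟪gradient φ x, j z⟫ = fderiv ℝ φ x (j z) := by
      simp [gradient]
    have hb₁ : ‖levyIntegrand j φ x z‖ ≤ T * ‖j z‖ ^ 2 := by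
      simpa [levyIntegrand, hz, hgrad] using hT (j z) hjR
    have hb₂ : T * ‖j z‖ ^ 2 ≤ T * C ^ 2 * ‖z‖ ^ q := by
      calc T * ‖j z‖ ^ 2 ≤ T * (|C| * ‖z‖ ^ (q / 2)) ^ 2 := by gcongr
        _ = T * C ^ 2 * ‖z‖ ^ q := by rw [mul_pow, hsq, sq_abs, mul_assoc]
    simpa [Set.indicator, hz, not_le.2 hz] using hb₁.trans hb₂
  · have hza : 1 ≤ ‖z‖ ^ a := Real.one_le_rpow hz ha
    have hzp : 1 ≤ ‖z‖ ^ p := Real.one_le_rpow hz ((mul_nonneg ha hb).trans hab)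
    have hzab : ‖z‖ ^ (a * b) ≤ ‖z‖ ^ p := Real.rpow_le_rpow_of_exponent_le hz hab
    have hD0 : 0 ≤ D := by positivity
    have hxj : ‖x + j z‖ ≤ D * ‖z‖ ^ a := by
      calc ‖x + j z‖ ≤ ‖x‖ + ‖j z‖ := norm_add_le _ _
        _ ≤ ‖x‖ * ‖z‖ ^ a + |C| * (‖z‖ ^ a + ‖z‖ ^ a) := by
          gcongr
          · exact le_mul_of_one_le_right (norm_nonneg x) hza
          · refine ((hj z).1 hz).trans ?_
            gcongr
            exact le_abs_self C
        _ = D * ‖z‖ ^ a := by ring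
    have hpow : ‖x + j z‖ ^ b ≤ D ^ b * ‖z‖ ^ p := by
      calc ‖x + j z‖ ^ b ≤ (D * ‖z‖ ^ a) ^ b := by gcongr
        _ = D ^ b * ‖z‖ ^ (a * b) := by
          rw [Real.mul_rpow hD0 (by positivity), ← Real.rpow_mul (norm_nonneg z)]
        _ ≤ D ^ b * ‖z‖ ^ p := by gcongr
    have hmain : |φ (x + j z) - φ x| ≤ (A * (1 + D ^ b) + |φ x|) * ‖z‖ ^ p := by
      calc |φ (x + j z) - φ x| ≤ |φ (x + j z)| + |φ x| := abs_sub _ _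
        _ ≤ A * (‖z‖ ^ p + D ^ b * ‖z‖ ^ p) + |φ x| * ‖z‖ ^ p := by
          gcongr
          · refine (hA _).trans ?_
            gcongr
          · exact le_mul_of_one_le_right (abs_nonneg _) hzp
        _ = _ := by ring
    simpa [levyIntegrand, Set.indicator, hz, not_lt.2 hz] using hmain

theorem hess_linear_comb {d : ℕ} {φ ψ : Euc d → ℝ} (hφ : ContDiff ℝ 2 φ) (hψ : ContDiff ℝ 2 ψ)
    (p q : ℝ) (x : Euc d) :
    hess (fun y => p * φ y + q * ψ y) x = p • hess φ x + q • hess ψ x := by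
  have h : iteratedFDeriv ℝ 2 (fun y => p * φ y + q * ψ y) x =
      p • iteratedFDeriv ℝ 2 φ x + q • iteratedFDeriv ℝ 2 ψ x := by
    have := iteratedFDeriv_add_apply (𝕜 := ℝ) (i := 2) (x := x) (f := p • φ) (g := q • ψ)
      (hφ.const_smul p).contDiffAt (hψ.const_smul q).contDiffAt
    rw [iteratedFDeriv_const_smul_apply hφ.contDiffAt,
      iteratedFDeriv_const_smul_apply hψ.contDiffAt] at this
    exact this
  ext i j
  simp [hess, h]

theorem gradient_linear_comb {d : ℕ} {φ ψ : Euc d → ℝ} {x : Euc d}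
    (hφ : DifferentiableAt ℝ φ x) (hψ : DifferentiableAt ℝ ψ x) (p q : ℝ) :
    gradient (fun y => p * φ y + q * ψ y) x = p • gradient φ x + q • gradient ψ x := by
  have h : fderiv ℝ (fun y => p * φ y + q * ψ y) x = p • fderiv ℝ φ x + q • fderiv ℝ ψ x :=
    ((hφ.hasFDerivAt.const_mul p).add (hψ.hasFDerivAt.const_mul q)).fderiv
  simp [gradient, h]

theorem Lop_linear_comb {d dm k : ℕ} {B : Type*}
    (σ : Euc d → B → Matrix (Fin d) (Fin dm) ℝ) (μ : Euc d → B → Euc d)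
    (c : Euc d → ℝ) (ν : Measure (Euc k)) (ℓ : Euc d → B → Euc k → Euc d) (β : B)
    {φ ψ : Euc d → ℝ} (hφ : ContDiff ℝ 2 φ) (hψ : ContDiff ℝ 2 ψ) (p q : ℝ) (x : Euc d)
    (hφi : Integrable (levyIntegrand (ℓ x β) φ x) ν)
    (hψi : Integrable (levyIntegrand (ℓ x β) ψ x) ν) :
    Lop σ μ c ν ℓ β (fun y => p * φ y + q * ψ y) x =
      p * Lop σ μ c ν ℓ β φ x + q * Lop σ μ c ν ℓ β ψ x := by
  have hgrad := gradient_linear_comb (hφ.differentiable two_ne_zero x)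
    (hψ.differentiable two_ne_zero x) p q
  have hint : ∫ z, levyIntegrand (ℓ x β) (fun y => p * φ y + q * ψ y) x z ∂ν =
      p * ∫ z, levyIntegrand (ℓ x β) φ x z ∂ν + q * ∫ z, levyIntegrand (ℓ x β) ψ x z ∂ν := by
    rw [← integral_const_mul, ← integral_const_mul,
      ← integral_add (hφi.const_mul p) (hψi.const_mul q)]
    congr 1 with z
    simp only [levyIntegrand, hgrad, inner_add_left, real_inner_smul_left]
    split_ifs <;> ring
  unfold levyIntegrand at hint
  simp only [Lop, hint, hess_linear_comb hφ hψ]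
  simp only [hgrad, inner_add_right, real_inner_smul_right, Matrix.mul_add, Matrix.mul_smul,
    Matrix.trace_add, Matrix.trace_smul, smul_eq_mul]
  ring

theorem bddAbove_range_Lop_add {d dm k : ℕ} {B : Type*} [TopologicalSpace B] [CompactSpace B]
    {σ : Euc d → B → Matrix (Fin d) (Fin dm) ℝ} {μ : Euc d → B → Euc d} {f : Euc d → B → ℝ}
    (c : Euc d → ℝ) {ν : Measure (Euc k)} {ℓ : Euc d → B → Euc k → Euc d}
    {φ : Euc d → ℝ} {x : Euc d} (hσ : Continuous (σ x)) (hμ : Continuous (μ x))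
    (hf : Continuous (f x)) {G : Euc k → ℝ} (hG : Integrable G ν)
    (hbound : ∀ β z, ‖levyIntegrand (ℓ x β) φ x z‖ ≤ G z) :
    BddAbove (Set.range fun β => Lop σ μ c ν ℓ β φ x + f x β) := by
  have hcont : Continuous fun β => (1 / 2) * Matrix.trace (σ x β * (σ x β)ᵀ * hess φ x)
      + ⟪μ x β, gradient φ x⟫ - c x * φ x + f x β := by fun_prop
  obtain ⟨A, hA⟩ := (isCompact_range hcont).bddAbove
  refine ⟨A + ∫ z, G z ∂ν, ?_⟩
  rintro _ ⟨β, rfl⟩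
  have h₁ := hA ⟨β, rfl⟩
  have h₂ : ∫ z, levyIntegrand (ℓ x β) φ x z ∂ν ≤ ∫ z, G z ∂ν :=
    (le_abs_self _).trans
      (norm_integral_le_of_norm_le hG (Filter.Eventually.of_forall (hbound β)))
  unfold levyIntegrand at h₂
  simp only [Lop] at h₁ ⊢
  linarith

theorem IsSubsol.mono {d dm k : ℕ} {B : Type*} {S : Set (Euc d)}
    {σ : Euc d → B → Matrix (Fin d) (Fin dm) ℝ} {μ : Euc d → B → Euc d}
    {f : Euc d → B → ℝ} {c : Euc d → ℝ} {g : Euc d → ℝ} {ν : Measure (Euc k)}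
    {ℓ : Euc d → B → Euc k → Euc d} {Γ : Euc d → Euc d → Euc d} {K : Euc d → Euc d → ℝ}
    {Z : Euc d → Set (Euc d)} {b : ℝ} {r s : Euc d → ℝ} {u : Euc d → ℝ}
    (h : IsSubsol S σ μ f c g ν ℓ Γ K Z b r u) (hrs : ∀ x, r x ≤ s x) :
    IsSubsol S σ μ f c g ν ℓ Γ K Z b s u :=
  ⟨h.1, fun x φ hφ hφ' heq hmax =>
    ⟨fun hx => ((h.2 x φ hφ hφ' heq hmax).1 hx).trans (hrs x),
      fun hx => ((h.2 x φ hφ hφ' heq hmax).2 hx).trans (hrs x)⟩⟩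

/-- If `u ≤ Mu` at `x` and `w ≥ Mw` with margin `κ`, then the extrapolation
`v = (1 + t) u - t w` satisfies `v ≤ Mv` at `x` with margin `t κ`. -/
theorem sub_Mop_extrapolation_le {d : ℕ} {Γ : Euc d → Euc d → Euc d} {K : Euc d → Euc d → ℝ}
    {Z : Euc d → Set (Euc d)} {x : Euc d} (hZ : (Z x).Nonempty) {u v w : Euc d → ℝ} {t κ : ℝ}
    (ht : 0 ≤ t) (hv : ∀ y, v y = (1 + t) * u y - t * w y)
    (hvb : BddAbove ((fun ζ => v (Γ x ζ) + K x ζ) '' Z x))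
    (hwb : BddAbove ((fun ζ => w (Γ x ζ) + K x ζ) '' Z x))
    (hw : κ ≤ w x - Mop Γ K Z w x) (hu : u x - Mop Γ K Z u x ≤ 0) :
    v x - Mop Γ K Z v x ≤ -(t * κ) := by
  have hM : Mop Γ K Z u x ≤ (Mop Γ K Z v x + t * Mop Γ K Z w x) / (1 + t) := by
    refine csSup_le (hZ.image _) ?_
    rintro _ ⟨ζ, hζ, rfl⟩
    have h₁ : v (Γ x ζ) + K x ζ ≤ Mop Γ K Z v x := le_csSup hvb ⟨ζ, hζ, rfl⟩
    have h₂ : w (Γ x ζ) + K x ζ ≤ Mop Γ K Z w x := le_csSup hwb ⟨ζ, hζ, rfl⟩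
    have h₃ := mul_le_mul_of_nonneg_left h₂ ht
    rw [le_div_iff₀ (by positivity)]
    have := hv (Γ x ζ)
    dsimp only
    linarith
  rw [le_div_iff₀ (by positivity)] at hM
  have h₁ := mul_le_mul_of_nonneg_left hw ht
  have h₂ := mul_le_mul_of_nonneg_right hu (by positivity : 0 ≤ 1 + t)
  have := hv x
  linarith

theorem neg_iSup_extrapolation_le {ι : Type*} [Nonempty ι] {F H W : ι → ℝ} {t κ : ℝ} (ht : 0 ≤ t)
    (hF : ∀ i, (1 + t) * H i = F i + t * W i) (hFb : BddAbove (Set.range F))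
    (hWb : BddAbove (Set.range W)) (hW : κ ≤ -(⨆ i, W i)) (hH : -(⨆ i, H i) ≤ 0) :
    -(⨆ i, F i) ≤ -(t * κ) := by
  have hsup : ⨆ i, H i ≤ ((⨆ i, F i) + t * ⨆ i, W i) / (1 + t) := by
    refine ciSup_le fun i => ?_
    have h₁ := le_ciSup hFb i
    have h₂ := mul_le_mul_of_nonneg_left (le_ciSup hWb i) ht
    rw [le_div_iff₀ (by positivity)]
    linarith [hF i]
  rw [le_div_iff₀ (by positivity)] at hsup
  have h₁ := mul_le_mul_of_nonneg_left hW ht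
  have h₂ : 0 ≤ (⨆ i, H i) * (1 + t) := mul_nonneg (by linarith) (by positivity)
  linarith

/-- if `w ∈ PB ∩ C²(ℝᵈ)` and a positive function `κ` satisfy
`min(−sup_β{L^β w + f^β}, w − Mw) ≥ κ` in `S` and `min(w − g, w − Mw) ≥ κ` in `ℝᵈ∖S`,
and `u` is a viscosity subsolution of the elliptic QVI, then for every `m ≥ 1` the
function `u_m := (1 + 1/m)u − (1/m)w` is a viscosity subsolution of the elliptic QVI,
and moreover a viscosity subsolution with right-hand side `−κ/m`. -/
theorem stmt15 {d dm k : ℕ} (hd : 1 ≤ d) (hk : 1 ≤ k)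
    {B : Type*} [MetricSpace B] [CompactSpace B] [Nonempty B]
    (S : Set (Euc d)) (hS : IsOpen S)
    (σ : Euc d → B → Matrix (Fin d) (Fin dm) ℝ)
    (hσ : Continuous (fun q : Euc d × B => σ q.1 q.2))
    (μ : Euc d → B → Euc d) (hμ : Continuous (fun q : Euc d × B => μ q.1 q.2))
    (f : Euc d → B → ℝ) (hf : Continuous (fun q : Euc d × B => f q.1 q.2))
    (c : Euc d → ℝ) (hc : Continuous c) (hc0 : ∀ x, 0 ≤ c x)
    (g : Euc d → ℝ) (hg : Continuous g)
    (ν : Measure (Euc k))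
    (hν : (∫⁻ z, ENNReal.ofReal (min (‖z‖ ^ 2) 1) ∂ν) ≠ ⊤)
    (ℓ : Euc d → B → Euc k → Euc d)
    (hℓ : Continuous (fun q : Euc d × B × Euc k => ℓ q.1 q.2.1 q.2.2))
    (a b pstar qstar : ℝ) (ha : 0 ≤ a) (hb : 0 ≤ b) (hpstar : 0 < pstar)
    (hab : a * b ≤ pstar) (hqstar : 0 ≤ qstar)
    (hνp : (∫⁻ z in {z : Euc k | 1 ≤ ‖z‖}, ENNReal.ofReal (‖z‖ ^ pstar) ∂ν) ≠ ⊤)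
    (hνq : (∫⁻ z in {z : Euc k | ‖z‖ < 1}, ENNReal.ofReal (‖z‖ ^ qstar) ∂ν) ≠ ⊤)
    (hgrowth : ∀ x : Euc d, ∃ U ∈ 𝓝 x, ∃ C : ℝ, ∀ x' ∈ U, ∀ (β : B) (z : Euc k),
      (1 ≤ ‖z‖ → ‖ℓ x' β z‖ ≤ C * (1 + ‖z‖ ^ a)) ∧
      (‖z‖ < 1 → ‖ℓ x' β z‖ ≤ C * ‖z‖ ^ (qstar / 2)))
    (Γ : Euc d → Euc d → Euc d) (hΓ : Continuous (fun q : Euc d × Euc d => Γ q.1 q.2))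
    (K : Euc d → Euc d → ℝ) (hK : Continuous (fun q : Euc d × Euc d => K q.1 q.2))
    (Z : Euc d → Set (Euc d))
    (hZne : ∀ x : Euc d, (Z x).Nonempty) (hZcp : ∀ x : Euc d, IsCompact (Z x))
    (hZH : ∀ (xs : ℕ → Euc d) (x : Euc d), Filter.Tendsto xs Filter.atTop (𝓝 x) →
      Filter.Tendsto (fun n => Metric.hausdorffDist (Z (xs n)) (Z x)) Filter.atTop (𝓝 (0:ℝ)))
    (w : Euc d → ℝ) (hwPB : PB b w) (hwC2 : ContDiff ℝ 2 w)
    (κ : Euc d → ℝ) (hκ : ∀ x, 0 < κ x)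
    (hwS : ∀ x ∈ S,
      κ x ≤ min (-(⨆ β : B, (Lop σ μ c ν ℓ β w x + f x β))) (w x - Mop Γ K Z w x))
    (hwSc : ∀ x ∉ S, κ x ≤ min (w x - g x) (w x - Mop Γ K Z w x))
    (u : Euc d → ℝ)
    (hu : IsSubsol S σ μ f c g ν ℓ Γ K Z b (fun _ => 0) u)
    (m : ℕ) (hm : 1 ≤ m) :
    IsSubsol S σ μ f c g ν ℓ Γ K Z b (fun _ => 0)
        (fun x => (1 + 1/(m:ℝ)) * u x - (1/(m:ℝ)) * w x) ∧
      IsSubsol S σ μ f c g ν ℓ Γ K Z b (fun x => -(κ x / m))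
        (fun x => (1 + 1/(m:ℝ)) * u x - (1/(m:ℝ)) * w x) := by
  have ht : 0 ≤ 1 / (m : ℝ) := by positivity
  suffices hmain : IsSubsol S σ μ f c g ν ℓ Γ K Z b (fun x => -(κ x / m))
      (fun x => (1 + 1/(m:ℝ)) * u x - (1/(m:ℝ)) * w x) by
    exact ⟨hmain.mono fun x => by
      have := (hκ x).le
      simp only [Left.neg_nonpos_iff]
      positivity, hmain⟩
  have hrhs : ∀ x, -(κ x / m) = -(1 / (m : ℝ) * κ x) := fun x => by ring
  simp only [hrhs]
  generalize 1 / (m : ℝ) = t at ht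
  have ht1 : 0 < 1 + t := by positivity
  have hvPB : PB b (fun x => (1 + t) * u x - t * w x) := by
    simpa only [sub_eq_add_neg, neg_mul] using hu.1.linear_comb hwPB (1 + t) (-t)
  have henv := uscEnv_mul_sub hb hu.1 hwC2.continuous ht1.le t
  refine ⟨hvPB, fun x φ hφPB hφ heq hmax => ?_⟩
  set v := fun x => (1 + t) * u x - t * w x
  set ψ : Euc d → ℝ := fun y => (1 / (1 + t)) * φ y + (t / (1 + t)) * w y with hψdef
  have hψ_eq : ∀ y, uscEnv u y - ψ y = (1 / (1 + t)) * (uscEnv v y - φ y) := by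
    intro y
    rw [henv y]
    simp only [hψdef]
    field_simp
    ring
  obtain ⟨huS, huSc⟩ := hu.2 x ψ (hφPB.linear_comb hwPB _ _)
    ((contDiff_const.mul hφ).add (contDiff_const.mul hwC2))
    (by
      have := hψ_eq x
      rw [heq, sub_self, mul_zero] at this
      exact sub_eq_zero.1 this)
    (fun y => by
      rw [hψ_eq, hψ_eq]
      exact mul_le_mul_of_nonneg_left (hmax y) (by positivity))
  have hΓx : Continuous (Γ x) := hΓ.comp (Continuous.prodMk_right x)
  have hKx : Continuous (K x) := hK.comp (Continuous.prodMk_right x)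
  have hobst : κ x ≤ w x - Mop Γ K Z w x → uscEnv u x - Mop Γ K Z (uscEnv u) x ≤ 0 →
      uscEnv v x - Mop Γ K Z (uscEnv v) x ≤ -(t * κ x) :=
    sub_Mop_extrapolation_le (hZne x) ht henv
      (bddAbove_image_Mop hΓx hKx (hZcp x) (hvPB.uscEnv_bounded_on_ball hb))
      (bddAbove_image_Mop hΓx hKx (hZcp x) fun R => by
        obtain ⟨A, hA⟩ := hwPB.bounded_on_ball hb R
        exact ⟨A, fun y hy => (abs_le.1 (hA y hy)).2⟩)
  refine ⟨fun hx => ?_, fun hx => ?_⟩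
  · obtain ⟨hwL, hwM⟩ := le_min_iff.1 (hwS x hx)
    rcases min_le_iff.1 (huS hx) with h | h
    · obtain ⟨U, hU, C, hC⟩ := hgrowth x
      have hjump := hC x (mem_of_mem_nhds hU)
      obtain ⟨G, hG, hGφ⟩ := exists_integrable_bound_levyIntegrand ha hb hab hqstar hνp hνq
        hφPB hφ x C
      obtain ⟨H, hH, hHw⟩ := exists_integrable_bound_levyIntegrand ha hb hab hqstar hνp hνq
        hwPB hwC2 x C
      have hℓx : ∀ β, Continuous (ℓ x β) := fun β => hℓ.comp (by fun_prop :
        Continuous fun z : Euc k => (x, β, z))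
      have hσx : Continuous (σ x) := hσ.comp (Continuous.prodMk_right x)
      have hμx : Continuous (μ x) := hμ.comp (Continuous.prodMk_right x)
      have hfx : Continuous (f x) := hf.comp (Continuous.prodMk_right x)
      refine min_le_of_left_le (neg_iSup_extrapolation_le ht (fun β => ?_)
        (bddAbove_range_Lop_add c hσx hμx hfx hG fun β => hGφ _ (hjump β))
        (bddAbove_range_Lop_add c hσx hμx hfx hH fun β => hHw _ (hjump β)) hwL h)
      rw [Lop_linear_comb σ μ c ν ℓ β hφ hwC2 _ _ x
        (hG.mono' (measurable_levyIntegrand (hℓx β) hφ.continuous x).aestronglyMeasurable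
          (Filter.Eventually.of_forall (hGφ _ (hjump β))))
        (hH.mono' (measurable_levyIntegrand (hℓx β) hwC2.continuous x).aestronglyMeasurable
          (Filter.Eventually.of_forall (hHw _ (hjump β))))]
      field_simp
      ring
    · exact min_le_of_right_le (hobst hwM h)
  · obtain ⟨hwg, hwM⟩ := le_min_iff.1 (hwSc x hx)
    rcases min_le_iff.1 (huSc hx) with h | h
    · refine min_le_of_left_le ?_
      rw [henv x]
      have h₁ := mul_le_mul_of_nonneg_left hwg ht
      have h₂ := mul_le_mul_of_nonneg_right h ht1.le
      linarith
    · exact min_le_of_right_le (hobst hwM h)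
end
end
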